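/- Let η*(ξ) = exp((1/(2d_σ))(‖ξ‖²/n − 1)) where ξ = (N_{1:λ}, N₂,...,N_n) with N_{1:λ} the minimum of λ i.i.d. standard normals, λ ≥ 3, and N₂,...,N_n i.i.d. standard normal, independent. Then there exists α > 0 such that E[(η*)^{-α}] < 1. -/

import Mathlib

open MeasureTheory ProbabilityTheory Filter

noncomputable def stdPi (n : ℕ) : Measure (Fin n → ℝ) :=
  Measure.pi fun _ => gaussianReal 0 1

/-- The `i`-th order statistic (0-indexed): the `i`-th smallest coordinate. -/
noncomputable def orderStat (n i : ℕ) (ω : Fin n → ℝ) : ℝ :=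
  ((List.ofFn ω).insertionSort (· ≤ ·)).getD i 0

/-- Law of the selected step on a linear function: first coordinate distributed as
the minimum of `lam` i.i.d. standard normals, the other coordinates standard normal,
all independent. -/
noncomputable def selLaw (n lam : ℕ) : Measure (Fin n → ℝ) :=
  Measure.pi fun i =>
    if (i : ℕ) = 0 then Measure.map (orderStat lam 0) (stdPi lam)
    else gaussianReal 0 1

open scoped Topology

lemma orderStat_zero_mem_iff {n : ℕ} (hn : 0 < n) {S : Set ℝ} (hS : IsUpperSet S)
    (ω : Fin n → ℝ) : orderStat n 0 ω ∈ S ↔ ∀ i, ω i ∈ S := by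
  unfold orderStat
  have hsort := List.pairwise_insertionSort (· ≤ · : ℝ → ℝ → Prop) (List.ofFn ω)
  have hmem (x : ℝ) : x ∈ (List.ofFn ω).insertionSort (· ≤ ·) ↔ ∃ i, ω i = x := by
    rw [List.mem_insertionSort, List.mem_ofFn]
  cases h : (List.ofFn ω).insertionSort (· ≤ ·) with
  | nil => simpa [h] using hmem (ω ⟨0, hn⟩)
  | cons a l =>
    rw [h] at hsort hmem
    rw [List.pairwise_cons] at hsort
    simp only [List.getD_cons_zero]
    refine ⟨fun ha i => ?_, fun hω => ?_⟩
    · rcases List.mem_cons.1 ((hmem (ω i)).2 ⟨i, rfl⟩) with hi | hi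
      · rwa [hi]
      · exact hS (hsort.1 _ hi) ha
    · obtain ⟨i, hi⟩ := (hmem a).1 List.mem_cons_self
      exact hi ▸ hω i

lemma exists_eq_orderStat_zero {n : ℕ} (hn : 0 < n) (ω : Fin n → ℝ) :
    ∃ i, ω i = orderStat n 0 ω := by
  have hge := (orderStat_zero_mem_iff hn (isUpperSet_Ici (orderStat n 0 ω)) ω).1 Set.self_mem_Ici
  by_contra! hne
  exact lt_irrefl (orderStat n 0 ω) <| (orderStat_zero_mem_iff hn (isUpperSet_Ioi (orderStat n 0 ω)) ω).2
    fun i => lt_of_le_of_ne (hge i) (hne i).symm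

lemma measurable_orderStat_zero {n : ℕ} (hn : 0 < n) : Measurable (orderStat n 0) := by
  refine measurable_of_Ioi fun a => ?_
  have : orderStat n 0 ⁻¹' Set.Ioi a = ⋂ i, {ω | a < ω i} := by
    ext ω
    simpa using orderStat_zero_mem_iff hn (isUpperSet_Ioi a) ω
  rw [this]
  exact MeasurableSet.iInter fun i => measurableSet_lt measurable_const (measurable_pi_apply i)

instance isProbabilityMeasure_stdPi (n : ℕ) : IsProbabilityMeasure (stdPi n) := by
  unfold stdPi
  infer_instance

lemma isProbabilityMeasure_map_orderStat_zero {n : ℕ} (hn : 0 < n) :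
    IsProbabilityMeasure ((stdPi n).map (orderStat n 0)) :=
  Measure.isProbabilityMeasure_map (measurable_orderStat_zero hn).aemeasurable

lemma map_orderStat_zero_real_isUpperSet {n : ℕ} (hn : 0 < n) {S : Set ℝ} (hS : IsUpperSet S)
    (hSm : MeasurableSet S) :
    ((stdPi n).map (orderStat n 0)).real S = (gaussianReal 0 1).real S ^ n := by
  rw [map_measureReal_apply (measurable_orderStat_zero hn) hSm]
  have : orderStat n 0 ⁻¹' S = Set.univ.pi fun _ => S := by
    ext ω
    simpa using orderStat_zero_mem_iff hn hS ω
  rw [this, stdPi, measureReal_def, Measure.pi_pi]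
  simp [measureReal_def]

lemma integrable_sq_gaussianReal : Integrable (fun x : ℝ => x ^ 2) (gaussianReal 0 1) :=
  (memLp_id_gaussianReal 2).integrable_sq

lemma integral_sq_gaussianReal : ∫ x : ℝ, x ^ 2 ∂(gaussianReal 0 1) = 1 := by
  have h := variance_of_integral_eq_zero (μ := gaussianReal 0 1) (X := id) aemeasurable_id
    (by simp [integral_id_gaussianReal])
  rw [variance_id_gaussianReal] at h
  simpa using h.symm

lemma integrable_sq_map_orderStat_zero {n : ℕ} (hn : 0 < n) :
    Integrable (fun x : ℝ => x ^ 2) ((stdPi n).map (orderStat n 0)) := by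
  rw [integrable_map_measure (by fun_prop) (measurable_orderStat_zero hn).aemeasurable]
  have hsum : Integrable (fun ω : Fin n → ℝ => ∑ i, ω i ^ 2) (stdPi n) :=
    integrable_finsetSum _ fun i _ =>
      (measurePreserving_eval (fun _ : Fin n => gaussianReal 0 1) i).integrable_comp_of_integrable
        integrable_sq_gaussianReal
  refine hsum.mono'
    ((measurable_orderStat_zero hn).pow_const 2).aestronglyMeasurable (ae_of_all _ fun ω => ?_)
  obtain ⟨i, hi⟩ := exists_eq_orderStat_zero hn ω
  simp only [Function.comp_apply, ← hi, norm_pow, Real.norm_eq_abs, sq_abs]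
  exact Finset.single_le_sum (f := fun i => ω i ^ 2) (fun j _ => sq_nonneg _) (Finset.mem_univ i)

lemma pow_sub_pow_lt_sub {p q : ℝ} (hq : 0 < q) (hqp : q < p) (hpq : p + q = 1) {n : ℕ}
    (hn : 3 ≤ n) : p ^ n - q ^ n < p - q := by
  obtain ⟨k, rfl⟩ := Nat.exists_eq_add_of_le' hn
  have hp : p < 1 := by linarith
  induction k with
  | zero =>
    have h1 : p ^ (0 + 3) - q ^ (0 + 3) = (p - q) - q * p * (p - q) := by
      obtain rfl : p = 1 - q := by linarith
      ring
    have h2 := mul_pos (mul_pos hq (hq.trans hqp)) (sub_pos.2 hqp)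
    linarith
  | succ k ih =>
    have h := ih (by omega)
    have h1 : p ^ (k + 1 + 3) - q ^ (k + 1 + 3)
        = (p ^ (k + 3) - q ^ (k + 3)) - p * q * (p ^ (k + 2) - q ^ (k + 2)) := by
      obtain rfl : p = 1 - q := by linarith
      ring
    have h2 : q ^ (k + 2) < p ^ (k + 2) := pow_lt_pow_left₀ hqp hq.le (by omega)
    have h3 := mul_pos (mul_pos (hq.trans hqp) hq) (sub_pos.2 h2)
    linarith

lemma setOf_lt_sq {s : ℝ} (hs : 0 ≤ s) :
    {x : ℝ | s < x ^ 2} = Set.Iio (-√s) ∪ Set.Ioi √s := by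
  ext x
  rw [Set.mem_ofPred_eq, ← Real.sqrt_lt_sqrt_iff hs, Real.sqrt_sq_eq_abs, lt_abs]
  simp only [Set.mem_union, Set.mem_Iio, Set.mem_Ioi]
  rw [or_comm, lt_neg]

lemma measureReal_setOf_lt_sq (μ : Measure ℝ) [IsFiniteMeasure μ] {s : ℝ} (hs : 0 ≤ s) :
    μ.real {x : ℝ | s < x ^ 2} = μ.real (Set.Iio (-√s)) + μ.real (Set.Ioi √s) := by
  rw [setOf_lt_sq hs, measureReal_union _ measurableSet_Ioi]
  rw [Set.disjoint_left]
  intro x hx hx'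
  have := Real.sqrt_nonneg s
  simp only [Set.mem_Iio, Set.mem_Ioi] at hx hx'
  linarith

lemma gaussianReal_real_pos_of_isOpen {U : Set ℝ} (hU : IsOpen U) (hne : U.Nonempty) :
    0 < (gaussianReal 0 1).real U := by
  rw [measureReal_def, ENNReal.toReal_pos_iff]
  refine ⟨pos_iff_ne_zero.2 fun h => ?_, measure_lt_top _ _⟩
  exact (hU.measure_pos volume hne).ne' (gaussianReal_absolutelyContinuous' 0 one_ne_zero h)

lemma gaussianReal_real_Iio_neg (r : ℝ) :
    (gaussianReal 0 1).real (Set.Iio (-r)) = (gaussianReal 0 1).real (Set.Ioi r) := by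
  have h : (gaussianReal 0 1).map (fun x => -x) = gaussianReal 0 1 := by
    simpa using gaussianReal_map_neg (μ := 0) (v := 1)
  conv_lhs => rw [← h]
  rw [map_measureReal_apply measurable_neg measurableSet_Iio]
  congr 1
  ext x
  simp

lemma gaussianReal_setOf_lt_sq_lt_map_orderStat_zero {n : ℕ} (hn : 3 ≤ n) {s : ℝ} (hs : 0 < s) :
    gaussianReal 0 1 {x | s < x ^ 2} < (stdPi n).map (orderStat n 0) {x | s < x ^ 2} := by
  have hn0 : 0 < n := by omega
  have := isProbabilityMeasure_map_orderStat_zero hn0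
  rw [← ENNReal.toReal_lt_toReal (measure_ne_top _ _) (measure_ne_top _ _)]
  change (gaussianReal 0 1).real _ < ((stdPi n).map (orderStat n 0)).real _
  have hr : 0 < √s := Real.sqrt_pos.2 hs
  rw [measureReal_setOf_lt_sq _ hs.le, measureReal_setOf_lt_sq _ hs.le,
    map_orderStat_zero_real_isUpperSet hn0 (isUpperSet_Ioi _) measurableSet_Ioi,
    ← Set.compl_Ici, probReal_compl_eq_one_sub measurableSet_Ici,
    probReal_compl_eq_one_sub measurableSet_Ici,
    map_orderStat_zero_real_isUpperSet hn0 (isUpperSet_Ici _) measurableSet_Ici]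
  have hq : 0 < (gaussianReal 0 1).real (Set.Ioi √s) :=
    gaussianReal_real_pos_of_isOpen isOpen_Ioi Set.nonempty_Ioi
  have hsum : (gaussianReal 0 1).real (Set.Ici (-√s)) + (gaussianReal 0 1).real (Set.Ioi √s)
      = 1 := by
    rw [← gaussianReal_real_Iio_neg, ← Set.compl_Ici,
      probReal_compl_eq_one_sub measurableSet_Ici]
    ring
  have hlt : (gaussianReal 0 1).real (Set.Ioi √s) < (gaussianReal 0 1).real (Set.Ici (-√s)) := by
    have hmid : 0 < (gaussianReal 0 1).real (Set.Ioo (-√s) √s) :=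
      gaussianReal_real_pos_of_isOpen isOpen_Ioo (Set.nonempty_Ioo.2 (by linarith))
    have hdisj : Disjoint (Set.Ioo (-√s) √s) (Set.Ioi √s) :=
      Set.disjoint_left.2 fun x hx hx' => lt_asymm hx.2 hx'
    have hsub : Set.Ioo (-√s) √s ∪ Set.Ioi √s ⊆ Set.Ici (-√s) :=
      Set.union_subset (fun x hx => hx.1.le)
        fun x hx => (by linarith : -√s ≤ √s).trans (le_of_lt hx)
    have := measureReal_mono (μ := gaussianReal 0 1) hsub
    rw [measureReal_union hdisj measurableSet_Ioi] at this
    linarith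
  have := pow_sub_pow_lt_sub hq hlt hsum hn
  linarith

lemma one_lt_integral_sq_map_orderStat_zero {n : ℕ} (hn : 3 ≤ n) :
    1 < ∫ x, x ^ 2 ∂((stdPi n).map (orderStat n 0)) := by
  have hint := integrable_sq_map_orderStat_zero (n := n) (by omega)
  rw [← integral_sq_gaussianReal]
  refine lt_of_not_ge fun hle => ?_
  have hle' := ENNReal.ofReal_le_ofReal hle
  have hnn (μ : Measure ℝ) : 0 ≤ᵐ[μ] fun x : ℝ => x ^ 2 := ae_of_all _ fun x => sq_nonneg x
  rw [ofReal_integral_eq_lintegral_ofReal hint (hnn _),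
    ofReal_integral_eq_lintegral_ofReal integrable_sq_gaussianReal (hnn _)] at hle'
  have hfin : ∫⁻ x : ℝ, ENNReal.ofReal (x ^ 2) ∂(gaussianReal 0 1) ≠ ⊤ := by
    rw [← ofReal_integral_eq_lintegral_ofReal integrable_sq_gaussianReal (hnn _)]
    exact ENNReal.ofReal_ne_top
  rw [lintegral_eq_lintegral_meas_lt _ (hnn _) (by fun_prop)] at hfin
  rw [lintegral_eq_lintegral_meas_lt _ (hnn _) (by fun_prop),
    lintegral_eq_lintegral_meas_lt _ (hnn _) (by fun_prop)] at hle'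
  refine hle'.not_gt (lintegral_strict_mono ?_ ?_ hfin ?_)
  · simp
  · refine Antitone.measurable (fun s t hst => measure_mono fun x hx => ?_) |>.aemeasurable
    exact lt_of_le_of_lt hst hx
  · filter_upwards [ae_restrict_mem measurableSet_Ioi] with s hs
    exact gaussianReal_setOf_lt_sq_lt_map_orderStat_zero hn hs

/-- A random variable which is bounded below and has positive mean has a Laplace transform
smaller than one somewhere on the positive half-line. -/
lemma exists_pos_integral_exp_neg_mul_lt_one {Ω : Type*} [MeasurableSpace Ω] {μ : Measure Ω}
    [IsProbabilityMeasure μ] {Y : Ω → ℝ} (hY : Integrable Y μ) {K : ℝ} (hK : 0 ≤ K)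
    (hlow : ∀ ω, -K ≤ Y ω) (hpos : 0 < ∫ ω, Y ω ∂μ) :
    ∃ α : ℝ, 0 < α ∧ ∫ ω, Real.exp (-α * Y ω) ∂μ < 1 := by
  have hbound {a : ℝ} (ha : 0 < a) (ha1 : a ≤ 1) (ω : Ω) :
      ‖a⁻¹ * (1 - Real.exp (-a * Y ω))‖ ≤ Real.exp K * |Y ω| := by
    have hy := hlow ω
    have haK : -a * Y ω ≤ K := by nlinarith
    have h1 := Real.add_one_le_exp (-a * Y ω)
    have h2 := Real.add_one_le_exp (a * Y ω)
    have h3 : Real.exp (-a * Y ω) * Real.exp (a * Y ω) = 1 := by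
      rw [← Real.exp_add]; simp
    have hK1 := Real.one_le_exp hK
    have hE := Real.exp_le_exp.2 haK
    have hE0 := Real.exp_pos (-a * Y ω)
    rw [norm_mul, norm_inv, Real.norm_of_nonneg ha.le, inv_mul_le_iff₀ ha, Real.norm_eq_abs]
    have key : |a * Y ω| = a * |Y ω| := by rw [abs_mul, abs_of_pos ha]
    rw [show a * (Real.exp K * |Y ω|) = Real.exp K * |a * Y ω| by rw [key]; ring]
    have hab := abs_nonneg (a * Y ω)
    rw [abs_le]
    constructor
    · have := neg_abs_le (a * Y ω)
      nlinarith
    · have := le_abs_self (a * Y ω)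
      nlinarith
  have hmeas (a : ℝ) : AEStronglyMeasurable (fun ω => Real.exp (-a * Y ω)) μ :=
    Real.continuous_exp.comp_aestronglyMeasurable (hY.aestronglyMeasurable.const_mul (-a))
  let a : ℕ → ℝ := fun k => 1 / ((k : ℝ) + 1)
  have ha (k : ℕ) : 0 < a k := Nat.one_div_pos_of_nat
  have ha1 (k : ℕ) : a k ≤ 1 := by
    simp only [a]
    rw [div_le_one (by positivity)]
    linarith [(k.cast_nonneg : (0 : ℝ) ≤ k)]
  have hlim : Tendsto (fun k => ∫ ω, (a k)⁻¹ * (1 - Real.exp (-a k * Y ω)) ∂μ) atTop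
      (𝓝 (∫ ω, Y ω ∂μ)) := by
    refine tendsto_integral_of_dominated_convergence (fun ω => Real.exp K * |Y ω|)
      (fun k => (aestronglyMeasurable_const.sub (hmeas (a k))).const_mul _) (hY.abs.const_mul _)
      (fun k => ae_of_all _ (hbound (ha k) (ha1 k))) (ae_of_all _ fun ω => ?_)
    have hd : HasDerivAt (fun t : ℝ => -Real.exp (-t * Y ω)) (Y ω) 0 := by
      have h := (((hasDerivAt_id (0 : ℝ)).neg.mul_const (Y ω)).exp).neg
      exact h.congr_deriv (by simp)
    have ht : Tendsto a atTop (𝓝[≠] 0) :=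
      tendsto_nhdsWithin_iff.2 ⟨tendsto_one_div_add_atTop_nhds_zero_nat,
        Eventually.of_forall fun k => (ha k).ne'⟩
    refine (hd.tendsto_slope_zero.comp ht).congr fun k => ?_
    simp [neg_add_eq_sub]
  obtain ⟨k, hk⟩ := (hlim.eventually_const_lt hpos).exists
  refine ⟨a k, ha k, ?_⟩
  have hexp : Integrable (fun ω => Real.exp (-a k * Y ω)) μ := by
    refine (integrable_const (Real.exp K)).mono' (hmeas _) (ae_of_all _ fun ω => ?_)
    rw [Real.norm_of_nonneg (Real.exp_pos _).le]
    refine Real.exp_le_exp.2 ?_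
    nlinarith [hlow ω, ha k, ha1 k]
  rw [integral_const_mul, integral_sub (integrable_const _) hexp] at hk
  have := pos_of_mul_pos_right hk (inv_pos.2 (ha k)).le
  simpa using this

theorem stmt_9 (n lam : ℕ) (hn : 1 ≤ n) (hlam : 3 ≤ lam) (d : ℝ) (hd : 0 < d) :
    ∃ α : ℝ, 0 < α ∧
      (∫ x, (Real.exp ((1 / (2 * d)) * ((∑ i, (x i) ^ 2) / n - 1))) ^ (-α)
          ∂(selLaw n lam)) < 1 := by
  have hn' : (0 : ℝ) < n := by exact_mod_cast hn
  let ν : Fin n → Measure ℝ := fun i =>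
    if (i : ℕ) = 0 then Measure.map (orderStat lam 0) (stdPi lam) else gaussianReal 0 1
  have hmin := isProbabilityMeasure_map_orderStat_zero (n := lam) (by omega)
  have hprob (i : Fin n) : IsProbabilityMeasure (ν i) := by
    by_cases hi : (i : ℕ) = 0
    · simpa [ν, hi] using hmin
    · simp only [ν, hi, if_false]
      infer_instance
  have hsel : selLaw n lam = Measure.pi ν := rfl
  have hint (i : Fin n) : Integrable (fun x : ℝ => x ^ 2) (ν i) := by
    by_cases hi : (i : ℕ) = 0
    · simpa [ν, hi] using integrable_sq_map_orderStat_zero (n := lam) (by omega)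
    · simpa [ν, hi] using integrable_sq_gaussianReal
  have hle (i : Fin n) : 1 ≤ ∫ x, x ^ 2 ∂(ν i) := by
    by_cases hi : (i : ℕ) = 0
    · simpa [ν, hi] using (one_lt_integral_sq_map_orderStat_zero hlam).le
    · simp [ν, hi, integral_sq_gaussianReal]
  have hlt : 1 < ∫ x, x ^ 2 ∂(ν ⟨0, hn⟩) := by
    simpa [ν] using one_lt_integral_sq_map_orderStat_zero hlam
  have hint' (i : Fin n) : Integrable (fun x : Fin n → ℝ => x i ^ 2) (Measure.pi ν) :=
    (measurePreserving_eval ν i).integrable_comp_of_integrable (hint i)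
  have hsum : Integrable (fun x : Fin n → ℝ => ∑ i, x i ^ 2) (Measure.pi ν) :=
    integrable_finsetSum _ fun i _ => hint' i
  have hmean : (n : ℝ) < ∫ x, ∑ i, x i ^ 2 ∂(Measure.pi ν) := by
    rw [integral_finsetSum _ fun i _ => hint' i]
    calc (n : ℝ) = ∑ _i : Fin n, (1 : ℝ) := by simp
      _ < ∑ i, ∫ x, x ^ 2 ∂(ν i) :=
        Finset.sum_lt_sum (fun i _ => hle i) ⟨⟨0, hn⟩, Finset.mem_univ _, hlt⟩
      _ = ∑ i, ∫ x : Fin n → ℝ, x i ^ 2 ∂(Measure.pi ν) :=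
        Finset.sum_congr rfl fun i _ =>
          (integral_comp_eval (μ := ν) (hint i).aestronglyMeasurable).symm
  have hdiff : Integrable (fun x : Fin n → ℝ => (∑ i, x i ^ 2) / n - 1) (Measure.pi ν) :=
    (hsum.div_const _).sub (integrable_const _)
  obtain ⟨α, hα, h⟩ := exists_pos_integral_exp_neg_mul_lt_one (K := 1 / (2 * d))
    (hdiff.const_mul (1 / (2 * d))) (by positivity)
    (fun x => by
      have h1 : 0 ≤ (∑ i, x i ^ 2) / (n : ℝ) := by positivity
      have h2 : 0 < 1 / (2 * d) := by positivity
      nlinarith)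
    (by
      rw [integral_const_mul, integral_sub (hsum.div_const _) (integrable_const _),
        integral_div]
      refine mul_pos (by positivity) ?_
      simpa using (one_lt_div hn').2 hmean)
  refine ⟨α, hα, ?_⟩
  rw [hsel]
  simpa only [← Real.exp_mul, mul_comm _ (-α)] using h
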